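/- arXiv:1102.2493 — 4 statements merged into one kernel-verified Lean document; each statement's English description precedes it below -/
import Mathlib

section
/- Let K be a field and P, Q ∈ GL_n(K). Then the subspaces P·Alt_n(K) and Q·Alt_n(K) of M_n(K) are similar if and only if P is congruent to λQ for some non-zero scalar λ, i.e. if and only if there exist λ ∈ K \ {0} and R ∈ GL_n(K) such that P = λ·R Q R^T. -/
open Matrix

/-- The set of alternate matrices: those `A` with `Xᵀ A X = 0` for all `X`. -/
def altSet (K : Type*) [Field K] (n : ℕ) : Set (Matrix (Fin n) (Fin n) K) :=
  {A | ∀ X : Fin n → K, X ⬝ᵥ A.mulVec X = 0}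

/-- Two subspaces of `M_n(K)` are similar if one is obtained from the other by conjugation. -/
def SimilarSets {K : Type*} [Field K] {n : ℕ}
    (V W : Set (Matrix (Fin n) (Fin n) K)) : Prop :=
  ∃ R : Matrix (Fin n) (Fin n) K, IsUnit R ∧ W = (fun M => R * M * R⁻¹) '' V

/-- Alternate matrices are stable under congruence. -/
lemma altSet_congr {K : Type*} [Field K] {n : ℕ} {A : Matrix (Fin n) (Fin n) K}
    (hA : A ∈ altSet K n) (R : Matrix (Fin n) (Fin n) K) : Rᵀ * A * R ∈ altSet K n := by
  intro X
  have h := hA (R *ᵥ X)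
  rwa [← vecMul_transpose, ← dotProduct_mulVec, vecMul_transpose, mulVec_mulVec, mulVec_mulVec] at h

lemma altSet_smul {K : Type*} [Field K] {n : ℕ} {A : Matrix (Fin n) (Fin n) K}
    (hA : A ∈ altSet K n) (c : K) : c • A ∈ altSet K n := by
  intro X
  rw [smul_mulVec, dotProduct_smul, hA X, smul_zero]

lemma single_sub_single_mulVec {K : Type*} [Field K] {n : ℕ} (i j : Fin n) (X : Fin n → K) :
    (single i j (1 : K) - single j i 1) *ᵥ X = X j • Pi.single i 1 - X i • Pi.single j 1 := by
  rw [sub_mulVec, single_mulVec, single_mulVec]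
  ext k
  simp [Pi.single_apply, Function.update_apply]

lemma single_sub_single_mem_altSet {K : Type*} [Field K] {n : ℕ} (i j : Fin n) :
    single i j (1 : K) - single j i 1 ∈ altSet K n := by
  intro X
  rw [single_sub_single_mulVec]
  simp [dotProduct_sub, mul_comm]

/-- A matrix whose left multiplication preserves the alternate matrices is scalar. -/
lemma scalar_of_mul_mem_altSet {K : Type*} [Field K] {n : ℕ} {S : Matrix (Fin n) (Fin n) K}
    (hS : ∀ A ∈ altSet K n, S * A ∈ altSet K n) (i₀ : Fin n) : S = S i₀ i₀ • 1 := by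
  have key (i j : Fin n) (X : Fin n → K) :
      X j * (X ⬝ᵥ S.col i) - X i * (X ⬝ᵥ S.col j) = 0 := by
    have h := hS _ (single_sub_single_mem_altSet i j) X
    rwa [← mulVec_mulVec, single_sub_single_mulVec, mulVec_sub, mulVec_smul, mulVec_smul,
      mulVec_single_one, mulVec_single_one, dotProduct_sub, dotProduct_smul, dotProduct_smul,
      smul_eq_mul, smul_eq_mul] at h
  have off (i j : Fin n) (hij : i ≠ j) : S i j = 0 := by
    simpa [hij, hij.symm] using key i j (Pi.single i 1)
  have diag (i j : Fin n) : S i i = S j j := by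
    by_cases hij : i = j
    · rw [hij]
    have h := key i j (Pi.single i 1 + Pi.single j 1)
    simp [add_dotProduct, hij, Ne.symm hij, off i j hij, off j i (Ne.symm hij)] at h
    exact sub_eq_zero.mp h
  ext i j
  by_cases hij : i = j
  · subst hij
    simp [diag i i₀]
  · simp [hij, off i j hij]

/-- For invertible `P, Q`, the subspaces `P·Alt_n(K)` and `Q·Alt_n(K)` are similar if and
only if `P = λ · R Q Rᵀ` for some non-zero scalar `λ` and invertible `R`. -/
theorem pAlt_similar_iff_congruent_scalar (K : Type*) [Field K] (n : ℕ)
    (P Q : Matrix (Fin n) (Fin n) K) (hP : IsUnit P) (hQ : IsUnit Q) :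
    SimilarSets ((fun A => P * A) '' altSet K n) ((fun A => Q * A) '' altSet K n) ↔
      ∃ c : K, c ≠ 0 ∧ ∃ R : Matrix (Fin n) (Fin n) K, IsUnit R ∧ P = c • (R * Q * Rᵀ) := by
  constructor
  · rintro ⟨R, hR, h⟩
    rcases n with _ | n
    · exact ⟨1, one_ne_zero, 1, isUnit_one, Subsingleton.elim _ _⟩
    have hRd := (isUnit_iff_isUnit_det R).mp hR
    have hQd := (isUnit_iff_isUnit_det Q).mp hQ
    have hRT : IsUnit Rᵀ := (isUnit_transpose R).mpr hR
    have hRTd := (isUnit_iff_isUnit_det Rᵀ).mp hRT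
    set S := Q⁻¹ * (R * P * Rᵀ) with hSdef
    have hS : ∀ A ∈ altSet K (n + 1), S * A ∈ altSet K (n + 1) := by
      intro A hA
      have hm : R * (P * (Rᵀ * A * R)) * R⁻¹ ∈ (fun A => Q * A) '' altSet K (n + 1) := by
        rw [h]
        exact ⟨_, ⟨_, altSet_congr hA R, rfl⟩, rfl⟩
      obtain ⟨B, hB, hBe⟩ := hm
      have : S * A = B := by
        rw [← nonsing_inv_mul_cancel_left Q B hQd, show Q * B = _ from hBe, hSdef]
        simp only [Matrix.mul_assoc, mul_nonsing_inv _ hRd, Matrix.mul_one]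
      rwa [this]
    have hSu : IsUnit S :=
      ((isUnit_nonsing_inv_iff).mpr hQ).mul ((hR.mul hP).mul hRT)
    have hSc := scalar_of_mul_mem_altSet hS 0
    have hc : S 0 0 ≠ 0 := by
      intro hc
      rw [hc, zero_smul] at hSc
      exact hSu.ne_zero hSc
    have hPQ : R * P * Rᵀ = S 0 0 • Q := by
      rw [← mul_nonsing_inv_cancel_left Q (R * P * Rᵀ) hQd, ← hSdef]
      conv_lhs => rw [hSc]
      simp
    refine ⟨S 0 0, hc, R⁻¹, (isUnit_nonsing_inv_iff).mpr hR, ?_⟩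
    rw [← Matrix.smul_mul, ← Matrix.mul_smul, ← hPQ, transpose_nonsing_inv, Matrix.mul_assoc R,
      nonsing_inv_mul_cancel_left _ _ hRd, mul_nonsing_inv_cancel_right _ _ hRTd]
  · rintro ⟨c, hc, R, hR, rfl⟩
    have hRd := (isUnit_iff_isUnit_det R).mp hR
    have conj (A : Matrix (Fin n) (Fin n) K) :
        R⁻¹ * (c • (R * Q * Rᵀ) * A) * R = Q * (c • (Rᵀ * A * R)) := by
      simp only [Matrix.mul_assoc, Matrix.smul_mul, Matrix.mul_smul,
        nonsing_inv_mul_cancel_left _ _ hRd]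
    refine ⟨R⁻¹, (isUnit_nonsing_inv_iff).mpr hR, ?_⟩
    rw [nonsing_inv_nonsing_inv _ hRd]
    ext M
    constructor
    · rintro ⟨A, hA, rfl⟩
      refine ⟨_, ⟨_, altSet_smul (altSet_congr hA R⁻¹) c⁻¹, rfl⟩, ?_⟩
      have hT : Rᵀ * R⁻¹ᵀ = 1 := by
        rw [← transpose_mul, nonsing_inv_mul _ hRd, transpose_one]
      have hA' : c • (Rᵀ * (c⁻¹ • (R⁻¹ᵀ * A * R⁻¹)) * R) = A := by
        rw [Matrix.mul_smul, Matrix.smul_mul, smul_smul, mul_inv_cancel₀ hc, one_smul,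
          ← Matrix.mul_assoc, ← Matrix.mul_assoc, hT, Matrix.one_mul,
          nonsing_inv_mul_cancel_right _ _ hRd]
      exact (conj _).trans (by rw [hA'])
    · rintro ⟨_, ⟨A, hA, rfl⟩, rfl⟩
      exact ⟨_, altSet_smul (altSet_congr hA R) c, (conj A).symm⟩
end

section
/- Let K be a field and P, Q ∈ GL_n(K) be non-isotropic matrices. Then the affine subspaces I_n + P·Alt_n(K) and I_n + Q·Alt_n(K) of M_n(K) are equivalent if and only if the quadratic forms X ↦ X^T P X and X ↦ X^T Q X are similar, i.e. if and only if there exist λ ∈ K \ {0} and R ∈ GL_n(K) such that λQ − R P R^T is an alternate matrix. -/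
open Matrix

/-- A matrix `P` is non-isotropic if `Xᵀ P X ≠ 0` for every non-zero `X`. -/
def nonIsotropic {K : Type*} [Field K] {n : ℕ} (P : Matrix (Fin n) (Fin n) K) : Prop :=
  ∀ X : Fin n → K, X ≠ 0 → X ⬝ᵥ P.mulVec X ≠ 0

/-- Two subsets of `M_n(K)` are equivalent if `W = R V S` for invertible `R, S`. -/
def EquivSets {K : Type*} [Field K] {n : ℕ}
    (V W : Set (Matrix (Fin n) (Fin n) K)) : Prop :=
  ∃ R S : Matrix (Fin n) (Fin n) K, IsUnit R ∧ IsUnit S ∧ W = (fun M => R * M * S) '' V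

section AltSet

variable {K : Type*} [Field K] {n : ℕ} {A B : Matrix (Fin n) (Fin n) K}

theorem zero_mem_altSet : (0 : Matrix (Fin n) (Fin n) K) ∈ altSet K n := fun X => by simp

theorem add_mem_altSet (hA : A ∈ altSet K n) (hB : B ∈ altSet K n) : A + B ∈ altSet K n :=
  fun X => by rw [add_mulVec, dotProduct_add, hA X, hB X, add_zero]

theorem smul_mem_altSet (c : K) (hA : A ∈ altSet K n) : c • A ∈ altSet K n :=
  fun X => by rw [smul_mulVec, dotProduct_smul, hA X, smul_zero]

theorem neg_mem_altSet (hA : A ∈ altSet K n) : -A ∈ altSet K n := by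
  simpa using smul_mem_altSet (-1) hA

theorem sub_mem_altSet (hA : A ∈ altSet K n) (hB : B ∈ altSet K n) : A - B ∈ altSet K n := by
  simpa [sub_eq_add_neg] using add_mem_altSet hA (neg_mem_altSet hB)

theorem transpose_mem_altSet (hA : A ∈ altSet K n) : Aᵀ ∈ altSet K n := fun X => by
  rw [mulVec_transpose, dotProduct_comm, ← dotProduct_mulVec]
  exact hA X

theorem conj_mem_altSet (M : Matrix (Fin n) (Fin n) K) (hA : A ∈ altSet K n) :
    M * A * Mᵀ ∈ altSet K n := fun X => by
  have h := hA (Mᵀ *ᵥ X)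
  rwa [mulVec_transpose, ← dotProduct_mulVec, ← mulVec_transpose, mulVec_mulVec, mulVec_mulVec] at h

theorem vecMulVec_sub_mem_altSet (u v : Fin n → K) :
    vecMulVec u v - vecMulVec v u ∈ altSet K n := fun X => by
  rw [sub_mulVec, vecMulVec_mulVec, vecMulVec_mulVec]
  simp [dotProduct_comm X, mul_comm]

/-- A matrix that preserves alternate matrices by right multiplication maps every vector to a
multiple of itself. -/
theorem mul_mulVec_comm_of_mul_mem_altSet {U : Matrix (Fin n) (Fin n) K}
    (h : ∀ A ∈ altSet K n, A * U ∈ altSet K n) (X : Fin n → K) (i j : Fin n) :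
    X i * (U *ᵥ X) j = X j * (U *ᵥ X) i := by
  have := h _ (vecMulVec_sub_mem_altSet (Pi.single i 1) (Pi.single j 1)) X
  rw [← mulVec_mulVec, sub_mulVec, vecMulVec_mulVec, vecMulVec_mulVec] at this
  simpa [sub_eq_zero, mul_comm] using this

theorem exists_eq_smul_one_of_mul_mem_altSet {U : Matrix (Fin n) (Fin n) K} (hU : IsUnit U)
    (h : ∀ A ∈ altSet K n, A * U ∈ altSet K n) :
    ∃ c : K, c ≠ 0 ∧ U = c • (1 : Matrix (Fin n) (Fin n) K) := by
  rcases n with _ | n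
  · exact ⟨1, one_ne_zero, Subsingleton.elim _ _⟩
  have hoff : ∀ i j, i ≠ j → U j i = 0 := fun i j hij => by
    simpa [hij.symm] using mul_mulVec_comm_of_mul_mem_altSet h (Pi.single i 1) i j
  have hdiag : ∀ i j, U j j = U i i := fun i j => by
    by_cases hij : i = j
    · rw [hij]
    have := mul_mulVec_comm_of_mul_mem_altSet h (Pi.single i 1 + Pi.single j 1) i j
    rw [mulVec_add, mulVec_single_one, mulVec_single_one] at this
    simpa only [Pi.add_apply, col_apply, Pi.single_eq_same, Pi.single_eq_of_ne hij,
      Pi.single_eq_of_ne (Ne.symm hij), hoff i j hij, hoff j i (Ne.symm hij), zero_add, add_zero,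
      one_mul] using this
  have hUc : U = U 0 0 • (1 : Matrix (Fin (n + 1)) (Fin (n + 1)) K) := by
    ext i j
    by_cases hij : i = j
    · subst hij
      simpa using hdiag 0 i
    · simpa [hij] using hoff j i (Ne.symm hij)
  refine ⟨U 0 0, fun h0 => ?_, hUc⟩
  rw [h0, zero_smul] at hUc
  exact not_isUnit_zero (hUc ▸ hU)

/-- Two invertible matrices whose equivalence preserves alternate matrices are, up to a scalar,
transposes of each other. -/
theorem exists_eq_smul_transpose_of_mul_mul_mem_altSet {R S : Matrix (Fin n) (Fin n) K}
    (hR : IsUnit R) (hS : IsUnit S) (h : ∀ A ∈ altSet K n, R * A * S ∈ altSet K n) :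
    ∃ c : K, c ≠ 0 ∧ S = c • Rᵀ := by
  have hRd := (isUnit_iff_isUnit_det R).1 hR
  have hRt : IsUnit Rᵀ := (isUnit_transpose _).2 hR
  have hRtd := (isUnit_iff_isUnit_det _).1 hRt
  obtain ⟨c, hc, hU⟩ := exists_eq_smul_one_of_mul_mem_altSet
    (U := S * Rᵀ⁻¹) (hS.mul (isUnit_nonsing_inv_iff.2 hRt)) fun A hA => by
      have := conj_mem_altSet R⁻¹ (h A hA)
      rwa [Matrix.mul_assoc R, nonsing_inv_mul_cancel_left _ _ hRd, transpose_nonsing_inv,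
        Matrix.mul_assoc] at this
  refine ⟨c, hc, ?_⟩
  rw [← nonsing_inv_mul_cancel_right Rᵀ S hRtd, hU, smul_mul_assoc, Matrix.one_mul]

end AltSet

/-- For non-isotropic invertible matrices `P, Q`, the affine subspaces `I_n + P·Alt_n(K)`
and `I_n + Q·Alt_n(K)` are equivalent if and only if the quadratic forms `X ↦ Xᵀ P X`
and `X ↦ Xᵀ Q X` are similar, i.e. `λ • Q - R * P * Rᵀ` is alternate for some non-zero
scalar `λ` and invertible `R`. -/
theorem affine_pAlt_equiv_iff_qf_similar (K : Type*) [Field K] (n : ℕ)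
    (P Q : Matrix (Fin n) (Fin n) K) (hP : IsUnit P) (hQ : IsUnit Q)
    (hPni : nonIsotropic P) (hQni : nonIsotropic Q) :
    EquivSets ((fun A => 1 + P * A) '' altSet K n) ((fun A => 1 + Q * A) '' altSet K n) ↔
      ∃ c : K, c ≠ 0 ∧ ∃ R : Matrix (Fin n) (Fin n) K, IsUnit R ∧
        c • Q - R * P * Rᵀ ∈ altSet K n := by
  have hPd := (isUnit_iff_isUnit_det P).1 hP
  have hQd := (isUnit_iff_isUnit_det Q).1 hQ
  have hQt : Qᵀ * Q⁻¹ᵀ = 1 := by rw [← transpose_mul, nonsing_inv_mul _ hQd, transpose_one]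
  constructor
  · rintro ⟨R₀, S, hR₀, hS, h⟩
    have hmem : ∀ A ∈ altSet K n, Q⁻¹ * R₀ * (1 + P * A) * S - Q⁻¹ ∈ altSet K n := by
      intro A hA
      obtain ⟨B, hB, hBA⟩ := h.symm.subset (Set.mem_image_of_mem _ (Set.mem_image_of_mem _ hA))
      have hBA : 1 + Q * B = R₀ * (1 + P * A) * S := hBA
      rwa [Matrix.mul_assoc Q⁻¹, Matrix.mul_assoc Q⁻¹, ← hBA, Matrix.mul_add, Matrix.mul_one,
        nonsing_inv_mul_cancel_left _ _ hQd, add_sub_cancel_left]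
    have h0 : Q⁻¹ * R₀ * S - Q⁻¹ ∈ altSet K n := by simpa using hmem 0 zero_mem_altSet
    have hR : IsUnit (Q⁻¹ * R₀ * P) := ((isUnit_nonsing_inv_iff.2 hQ).mul hR₀).mul hP
    obtain ⟨c, hc, rfl⟩ := exists_eq_smul_transpose_of_mul_mul_mem_altSet hR hS fun A hA => by
      convert sub_mem_altSet (hmem A hA) h0 using 1
      noncomm_ring
    refine ⟨c⁻¹, inv_ne_zero hc, R₀, hR₀, ?_⟩
    have h1 := neg_mem_altSet (smul_mem_altSet c⁻¹ (transpose_mem_altSet (conj_mem_altSet Q h0)))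
    convert h1 using 1
    have hQt' : Q⁻¹ᵀ * Qᵀ = 1 := by rw [← transpose_mul, mul_nonsing_inv _ hQd, transpose_one]
    have e : Q * (Q⁻¹ * R₀ * (c • (Q⁻¹ * R₀ * P)ᵀ) - Q⁻¹) * Qᵀ
        = c • (R₀ * Pᵀ * R₀ᵀ) - Qᵀ := by
      simp only [transpose_mul, Matrix.mul_smul, Matrix.mul_sub, Matrix.sub_mul, Matrix.smul_mul,
        Matrix.mul_assoc, hQt', mul_nonsing_inv_cancel_left _ _ hQd, Matrix.mul_one]
    rw [e]
    simp [smul_sub, smul_smul, hc, Matrix.mul_assoc]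
  · rintro ⟨c, hc, R, hR, h⟩
    obtain ⟨T, hT⟩ : ∃ T, T = Q⁻¹ * R * P := ⟨_, rfl⟩
    have hTu : IsUnit T := hT ▸ ((isUnit_nonsing_inv_iff.2 hQ).mul hR).mul hP
    have hTd := (isUnit_iff_isUnit_det T).1 hTu
    have hTt : T⁻¹ᵀ * Tᵀ = 1 := by rw [← transpose_mul, mul_nonsing_inv _ hTd, transpose_one]
    obtain ⟨D, hD⟩ : ∃ D, D = c⁻¹ • (T * P⁻¹ * Tᵀ) - Q⁻¹ := ⟨_, rfl⟩
    have hDm : D ∈ altSet K n := by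
      have h1 := neg_mem_altSet
        (smul_mem_altSet c⁻¹ (conj_mem_altSet Q⁻¹ (transpose_mem_altSet h)))
      convert h1 using 1
      simp [hD, hT, Matrix.mul_sub, Matrix.sub_mul, smul_sub, smul_smul, hc, Matrix.mul_assoc,
        mul_nonsing_inv_cancel_left _ _ hPd, hQt]
    have key : ∀ A, c⁻¹ • (Q * T * P⁻¹) * (1 + P * A) * Tᵀ
        = 1 + Q * (D + c⁻¹ • (T * A * Tᵀ)) := fun A => by
      simp [hD, Matrix.mul_add, Matrix.add_mul, Matrix.mul_sub, Matrix.mul_assoc,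
        nonsing_inv_mul_cancel_left _ _ hPd, mul_nonsing_inv _ hQd]
      abel
    refine ⟨c⁻¹ • (Q * T * P⁻¹), Tᵀ, ?_, (isUnit_transpose _).2 hTu, ?_⟩
    · have := ((hQ.mul hTu).mul (isUnit_nonsing_inv_iff.2 hP)).smul (Units.mk0 c⁻¹ (inv_ne_zero hc))
      exact this
    · ext M
      simp only [Set.mem_image, exists_exists_and_eq_and, key]
      constructor
      · rintro ⟨B, hB, rfl⟩
        refine ⟨c • (T⁻¹ * (B - D) * T⁻¹ᵀ),
          smul_mem_altSet c (conj_mem_altSet _ (sub_mem_altSet hB hDm)), ?_⟩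
        simp [Matrix.mul_assoc, smul_smul, hc, mul_nonsing_inv_cancel_left _ _ hTd, hTt]
      · rintro ⟨A, hA, rfl⟩
        exact ⟨_, add_mem_altSet hDm (smul_mem_altSet c⁻¹ (conj_mem_altSet T hA)), rfl⟩
end

section
/- Let K be a field. Let (P_1,…,P_p) and (Q_1,…,Q_q) be families of non-isotropic matrices with P_k ∈ GL_{n_k}(K) and Q_j ∈ GL_{m_j}(K), where n_1+⋯+n_p = m_1+⋯+m_q = n. Then the affine subspaces (I_{n_1}+P_1·Alt_{n_1}(K)) ∨ ⋯ ∨ (I_{n_p}+P_p·Alt_{n_p}(K)) and (I_{m_1}+Q_1·Alt_{m_1}(K)) ∨ ⋯ ∨ (I_{m_q}+Q_q·Alt_{m_q}(K)) of M_n(K) are equivalent if and only if q = p, n_k = m_k for every k, and the quadratic form X ↦ X^T P_k X is similar to X ↦ X^T Q_k X for every k ∈ {1,…,p}, i.e. for each k there exist λ_k ∈ K \ {0} and R_k ∈ GL_{n_k}(K) such that λ_k Q_k − R_k P_k R_k^T is alternate. -/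
open Matrix

/-- `V ∨ W`: block upper-triangular matrices with diagonal blocks in `V` and `W` and
arbitrary upper-right block. -/
def blockJoin {K : Type*} [Field K] {n p : ℕ}
    (V : Set (Matrix (Fin n) (Fin n) K)) (W : Set (Matrix (Fin p) (Fin p) K)) :
    Set (Matrix (Fin (n + p)) (Fin (n + p)) K) :=
  {M | ∃ A ∈ V, ∃ C ∈ W, ∃ B : Matrix (Fin n) (Fin p) K,
    M = Matrix.reindex finSumFinEquiv finSumFinEquiv (Matrix.fromBlocks A B 0 C)}

/-- Sum of the sizes in a list of (size, matrix) pairs. -/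
def sigSum {β : ℕ → Type*} : List (Σ m : ℕ, β m) → ℕ
  | [] => 0
  | x :: xs => x.1 + sigSum xs

/-- `(I_{n_1} + P_1·Alt_{n_1}(K)) ∨ ⋯ ∨ (I_{n_p} + P_p·Alt_{n_p}(K))` for a list of
pairs `(n_k, P_k)`. -/
def bdSetAff {K : Type*} [Field K] :
    (l : List (Σ m : ℕ, Matrix (Fin m) (Fin m) K)) →
      Set (Matrix (Fin (sigSum l)) (Fin (sigSum l)) K)
  | [] => Set.univ
  | x :: xs => blockJoin ((fun A => 1 + x.2 * A) '' altSet K x.1) (bdSetAff xs)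

/-- Same sizes, and the associated quadratic forms `X ↦ Xᵀ P X`, `X ↦ Xᵀ Q X` are similar:
there are `λ ≠ 0` and an invertible `R` with `λ • Q - R * P * Rᵀ` alternate. -/
def qfSimilar {K : Type*} [Field K] (x y : Σ m : ℕ, Matrix (Fin m) (Fin m) K) : Prop :=
  ∃ h : x.1 = y.1, ∃ c : K, c ≠ 0 ∧ ∃ R : Matrix (Fin x.1) (Fin x.1) K, IsUnit R ∧
    c • (Matrix.reindex (finCongr h.symm) (finCongr h.symm) y.2) - R * x.2 * Rᵀ
      ∈ altSet K x.1

section RectangularEquivalence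

variable {K : Type*} [Field K]
variable {m n o p : Type*} [Fintype m] [Fintype n] [Fintype o] [Fintype p]
variable [DecidableEq m] [DecidableEq n] [DecidableEq o] [DecidableEq p]

/-- Equivalence of sets of square matrices indexed by possibly different types: `M ↦ R * M * S`
identifies `V` with `W`, where `R` and `S` are invertible rectangular matrices. -/
def RectEquiv (V : Set (Matrix m m K)) (W : Set (Matrix n n K)) : Prop :=
  ∃ (R : Matrix n m K) (R' : Matrix m n K) (S : Matrix m n K) (S' : Matrix n m K),
    R * R' = 1 ∧ R' * R = 1 ∧ S * S' = 1 ∧ S' * S = 1 ∧ ∀ M, R * M * S ∈ W ↔ M ∈ V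

/-- The set of block upper-triangular matrices with diagonal blocks in `V` and `W`. -/
def sumJoin (V : Set (Matrix m m K)) (W : Set (Matrix n n K)) :
    Set (Matrix (m ⊕ n) (m ⊕ n) K) :=
  {M | ∃ A ∈ V, ∃ C ∈ W, ∃ B : Matrix m n K, M = fromBlocks A B 0 C}

/-- The set of matrices defining the same quadratic form as `P`. -/
def quadClass (P : Matrix m m K) : Set (Matrix m m K) :=
  {M | ∀ x : m → K, x ⬝ᵥ M *ᵥ x = x ⬝ᵥ P *ᵥ x}

/-- For every nonzero `x`, the vectors `M *ᵥ x` with `M ∈ V` span the whole space. -/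
def Separating (V : Set (Matrix m m K)) : Prop :=
  ∀ x : m → K, x ≠ 0 → ∀ y : m → K, (∀ M ∈ V, y ⬝ᵥ M *ᵥ x = 0) → y = 0

omit [DecidableEq m] [DecidableEq n] [DecidableEq o] [DecidableEq p] in
lemma dotProduct_mulVec_sandwich (R : Matrix n m K) (M : Matrix m o K) (S : Matrix o p K)
    (y : n → K) (x : p → K) :
    y ⬝ᵥ (R * M * S) *ᵥ x = (Rᵀ *ᵥ y) ⬝ᵥ M *ᵥ (S *ᵥ x) := by
  rw [Matrix.mul_assoc, ← mulVec_mulVec, ← mulVec_mulVec, dotProduct_mulVec, mulVec_transpose]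

omit [DecidableEq m] in
lemma mulVec_ne_zero_of_left_inv {S : Matrix m n K} {S' : Matrix n m K} (h : S' * S = 1)
    {x : n → K} (hx : x ≠ 0) : S *ᵥ x ≠ 0 := fun h0 => hx <| by
  rw [← one_mulVec x, ← h, ← mulVec_mulVec, h0, mulVec_zero]

namespace RectEquiv

lemma symm {V : Set (Matrix m m K)} {W : Set (Matrix n n K)} (h : RectEquiv V W) :
    RectEquiv W V := by
  obtain ⟨R, R', S, S', h1, h2, h3, h4, hM⟩ := h
  refine ⟨R', R, S', S, h2, h1, h4, h3, fun M => ?_⟩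
  rw [← hM]
  have : R * (R' * M * S') * S = (R * R') * M * (S' * S) := by simp only [Matrix.mul_assoc]
  rw [this, h1, h4, Matrix.one_mul, Matrix.mul_one]

lemma trans {V : Set (Matrix m m K)} {W : Set (Matrix n n K)} {U : Set (Matrix o o K)}
    (h : RectEquiv V W) (h' : RectEquiv W U) : RectEquiv V U := by
  obtain ⟨R, R', S, S', h1, h2, h3, h4, hM⟩ := h
  obtain ⟨T, T', Q, Q', k1, k2, k3, k4, kM⟩ := h'
  refine ⟨T * R, R' * T', S * Q, Q' * S', ?_, ?_, ?_, ?_, fun M => ?_⟩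
  · rw [Matrix.mul_assoc, ← Matrix.mul_assoc R, h1, Matrix.one_mul, k1]
  · rw [Matrix.mul_assoc, ← Matrix.mul_assoc T', k2, Matrix.one_mul, h2]
  · rw [Matrix.mul_assoc, ← Matrix.mul_assoc Q, k3, Matrix.one_mul, h3]
  · rw [Matrix.mul_assoc, ← Matrix.mul_assoc S', h4, Matrix.one_mul, k4]
  · rw [← hM, ← kM]
    simp only [Matrix.mul_assoc]

lemma card_eq {V : Set (Matrix m m K)} {W : Set (Matrix n n K)} (h : RectEquiv V W) :
    Fintype.card m = Fintype.card n := by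
  obtain ⟨R, R', -, -, h1, h2, -⟩ := h
  exact square_of_invertible R' R h2 h1

lemma reindex_image (e : m ≃ n) (V : Set (Matrix m m K)) :
    RectEquiv V (Matrix.reindex e e '' V) := by
  refine ⟨(1 : Matrix m m K).submatrix e.symm id, (1 : Matrix m m K).submatrix id e.symm,
    (1 : Matrix m m K).submatrix id e.symm, (1 : Matrix m m K).submatrix e.symm id,
    ?_, ?_, ?_, ?_, fun M => ?_⟩
  · rw [← submatrix_mul _ _ _ _ _ Function.bijective_id]; simp
  · rw [← submatrix_mul _ _ _ _ _ e.symm.bijective]; simp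
  · rw [← submatrix_mul _ _ _ _ _ e.symm.bijective]; simp
  · rw [← submatrix_mul _ _ _ _ _ Function.bijective_id]; simp
  · have : (1 : Matrix m m K).submatrix e.symm id * M * (1 : Matrix m m K).submatrix id e.symm
        = Matrix.reindex e e M := by
      conv_lhs => rw [← submatrix_id_id M]
      rw [← submatrix_mul _ _ _ _ _ Function.bijective_id,
        ← submatrix_mul _ _ _ _ _ Function.bijective_id, Matrix.one_mul, Matrix.mul_one]
      rfl
    rw [this]
    exact (Matrix.reindex e e).injective.mem_set_image

lemma separating {V : Set (Matrix m m K)} {W : Set (Matrix n n K)} (h : RectEquiv V W)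
    (hV : Separating V) : Separating W := by
  obtain ⟨R, R', S, S', h1, h2, h3, h4, hM⟩ := h
  intro x hx y hy
  have h0 : Rᵀ *ᵥ y = 0 := hV _ (mulVec_ne_zero_of_left_inv h4 hx) _ fun M hMV => by
    rw [← dotProduct_mulVec_sandwich]
    exact hy _ ((hM M).2 hMV)
  by_contra hy0
  exact mulVec_ne_zero_of_left_inv (S := Rᵀ) (S' := R'ᵀ)
    (by rw [← transpose_mul, h1, transpose_one]) hy0 h0

lemma nonempty {V : Set (Matrix m m K)} {W : Set (Matrix n n K)} (h : RectEquiv V W)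
    (hV : V.Nonempty) : W.Nonempty := by
  obtain ⟨R, R', S, S', h1, h2, h3, h4, hM⟩ := h
  obtain ⟨M, hMV⟩ := hV
  exact ⟨_, (hM M).2 hMV⟩

lemma isUnit {V : Set (Matrix m m K)} {W : Set (Matrix n n K)} (h : RectEquiv V W)
    (hV : ∀ M ∈ V, IsUnit M) : ∀ M ∈ W, IsUnit M := by
  obtain ⟨R, R', S, S', h1, h2, h3, h4, hM⟩ := h.symm
  intro M hMW
  obtain ⟨N, hN, -⟩ := isUnit_iff_exists.1 (hV _ ((hM M).2 hMW))
  refine IsUnit.of_mul_eq_one (S * N * R) ?_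
  calc M * (S * N * R) = R' * R * (M * (S * N * R)) := by rw [h2, Matrix.one_mul]
    _ = R' * (R * M * S * N) * R := by simp only [Matrix.mul_assoc]
    _ = 1 := by rw [hN, Matrix.mul_one, h2]

lemma sumJoin_congr {V : Set (Matrix m m K)} {V' : Set (Matrix n n K)}
    {W : Set (Matrix o o K)} {W' : Set (Matrix p p K)}
    (h : RectEquiv V V') (h' : RectEquiv W W') :
    RectEquiv (sumJoin V W) (sumJoin V' W') := by
  obtain ⟨R, R', S, S', h1, h2, h3, h4, hM⟩ := h
  obtain ⟨T, T', Q, Q', k1, k2, k3, k4, kM⟩ := h'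
  refine ⟨fromBlocks R 0 0 T, fromBlocks R' 0 0 T', fromBlocks S 0 0 Q, fromBlocks S' 0 0 Q',
    by simp [fromBlocks_multiply, *], by simp [fromBlocks_multiply, *],
    by simp [fromBlocks_multiply, *], by simp [fromBlocks_multiply, *], fun M => ?_⟩
  obtain ⟨A, B, D, C, rfl⟩ : ∃ A B D C, M = fromBlocks A B D C :=
    ⟨_, _, _, _, (fromBlocks_toBlocks M).symm⟩
  simp only [fromBlocks_multiply, sumJoin, Set.mem_ofPred_eq, fromBlocks_inj,
    Matrix.zero_mul, Matrix.mul_zero, add_zero, zero_add]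
  constructor
  · rintro ⟨A', hA, C', hC, B', rfl, -, hD, rfl⟩
    refine ⟨A, (hM _).1 hA, C, (kM _).1 hC, B, rfl, rfl, ?_, rfl⟩
    calc D = T' * T * D * (S * S') := by rw [k2, h3, Matrix.one_mul, Matrix.mul_one]
      _ = T' * (T * D * S) * S' := by simp only [Matrix.mul_assoc]
      _ = 0 := by rw [hD, Matrix.mul_zero, Matrix.zero_mul]
  · rintro ⟨_, hA, _, hC, B', rfl, rfl, rfl, rfl⟩
    exact ⟨_, (hM _).2 hA, _, (kM _).2 hC, _, rfl, rfl, by simp, rfl⟩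

end RectEquiv

/-- If no matrix of `sumJoin V W` pairs `y` with `x ≠ 0`, then `y` vanishes on the first block. -/
lemma comp_inl_eq_zero_of_sumJoin {V : Set (Matrix m m K)} {W : Set (Matrix n n K)}
    (hV : Separating V) (hV0 : V.Nonempty) (hW0 : W.Nonempty) {x y : m ⊕ n → K} (hx : x ≠ 0)
    (h : ∀ M ∈ sumJoin V W, y ⬝ᵥ M *ᵥ x = 0) : y ∘ Sum.inl = 0 := by
  obtain ⟨A₀, hA₀⟩ := hV0
  obtain ⟨C₀, hC₀⟩ := hW0
  obtain ⟨x₁, x₂, rfl⟩ : ∃ x₁ x₂, x = Sum.elim x₁ x₂ := ⟨_, _, (Sum.elim_comp_inl_inr x).symm⟩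
  obtain ⟨y₁, y₂, rfl⟩ : ∃ y₁ y₂, y = Sum.elim y₁ y₂ := ⟨_, _, (Sum.elim_comp_inl_inr y).symm⟩
  rw [Sum.elim_comp_inl]
  have key : ∀ A ∈ V, ∀ B, y₁ ⬝ᵥ A *ᵥ x₁ + y₁ ⬝ᵥ B *ᵥ x₂ + y₂ ⬝ᵥ C₀ *ᵥ x₂ = 0 := by
    intro A hA B
    have := h _ ⟨A, hA, C₀, hC₀, B, rfl⟩
    simpa [fromBlocks_mulVec, sumElim_dotProduct_sumElim, dotProduct_add] using this
  by_cases hx₂ : x₂ = 0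
  · subst hx₂
    refine hV x₁ (fun h0 => hx (by subst h0; ext (i | i) <;> rfl)) _ fun A hA => ?_
    simpa using key A hA 0
  · obtain ⟨j, hj⟩ := Function.ne_iff.1 hx₂
    ext i
    have h1 := key A₀ hA₀ 0
    have h2 := key A₀ hA₀ (Matrix.single i j 1)
    have h3 : y₁ ⬝ᵥ Matrix.single i j (1 : K) *ᵥ x₂ = 0 := by
      simp only [zero_mulVec, dotProduct_zero] at h1
      linear_combination h2 - h1
    rw [Matrix.single_mulVec] at h3
    have hj' : x₂ j ≠ 0 := hj
    simpa [hj', dotProduct, Function.update_apply] using h3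

lemma toBlocks₂₁_eq_zero_of_sumJoin {V : Set (Matrix m m K)} {W : Set (Matrix n n K)}
    {V' : Set (Matrix o o K)} {W' : Set (Matrix p p K)} [Nonempty o]
    (hV : Separating V) (hV0 : V.Nonempty) (hW0 : W.Nonempty)
    {R : Matrix (o ⊕ p) (m ⊕ n) K} {S : Matrix (m ⊕ n) (o ⊕ p) K} {S' : Matrix (o ⊕ p) (m ⊕ n) K}
    (hS : S' * S = 1) (h : ∀ M ∈ sumJoin V W, R * M * S ∈ sumJoin V' W') :
    R.toBlocks₂₁ = 0 := by
  have hx : (Sum.elim 1 0 : o ⊕ p → K) ≠ 0 := fun h0 =>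
    one_ne_zero (congrFun h0 (Sum.inl (Classical.arbitrary o)))
  ext i j
  have h0 := comp_inl_eq_zero_of_sumJoin hV hV0 hW0 (y := Rᵀ *ᵥ Pi.single (Sum.inr i) 1)
    (mulVec_ne_zero_of_left_inv hS hx) fun M hM => by
      rw [← dotProduct_mulVec_sandwich]
      obtain ⟨A, -, C, -, B, hABC⟩ := h M hM
      rw [hABC, single_dotProduct]
      simp [fromBlocks_mulVec]
  simpa [toBlocks₂₁] using congrFun h0 j

omit [Fintype o] [DecidableEq m] [DecidableEq o] [DecidableEq p] in
lemma toBlocks₂₁_eq_zero_of_mul {V : Set (Matrix m m K)} {W : Set (Matrix n n K)}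
    {V' : Set (Matrix o o K)} {W' : Set (Matrix p p K)}
    (hV0 : V.Nonempty) (hW0 : W.Nonempty) (hW : ∀ C ∈ W, IsUnit C)
    {R : Matrix (o ⊕ p) (m ⊕ n) K} {S : Matrix (m ⊕ n) (o ⊕ p) K} {T : Matrix n p K}
    (hR : R.toBlocks₂₁ = 0) (hT : T * R.toBlocks₂₂ = 1)
    (h : ∀ M ∈ sumJoin V W, R * M * S ∈ sumJoin V' W') :
    S.toBlocks₂₁ = 0 := by
  obtain ⟨A₀, hA₀⟩ := hV0
  obtain ⟨C₀, hC₀⟩ := hW0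
  obtain ⟨N, -, hN⟩ := isUnit_iff_exists.1 (hW C₀ hC₀)
  obtain ⟨A, -, C, -, B, hM⟩ := h _ ⟨A₀, hA₀, C₀, hC₀, 0, rfl⟩
  rw [← fromBlocks_toBlocks R, ← fromBlocks_toBlocks S, hR] at hM
  simp only [fromBlocks_multiply, fromBlocks_inj, Matrix.zero_mul, Matrix.mul_zero, add_zero,
    zero_add] at hM
  calc S.toBlocks₂₁ = N * C₀ * S.toBlocks₂₁ := by rw [hN, Matrix.one_mul]
    _ = N * (T * R.toBlocks₂₂) * C₀ * S.toBlocks₂₁ := by rw [hT, Matrix.mul_one]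
    _ = N * T * (R.toBlocks₂₂ * C₀ * S.toBlocks₂₁) := by simp only [Matrix.mul_assoc]
    _ = 0 := by rw [hM.2.2.1, Matrix.mul_zero]

omit [Fintype o] [Fintype p] [DecidableEq m] [DecidableEq n] in
lemma blocks_mul_eq_one {X : Matrix (o ⊕ p) (m ⊕ n) K} {Y : Matrix (m ⊕ n) (o ⊕ p) K}
    (hX : X.toBlocks₂₁ = 0) (hY : Y.toBlocks₂₁ = 0) (h : X * Y = 1) :
    X.toBlocks₁₁ * Y.toBlocks₁₁ = 1 ∧ X.toBlocks₂₂ * Y.toBlocks₂₂ = 1 := by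
  rw [← fromBlocks_toBlocks X, ← fromBlocks_toBlocks Y, hX, hY, fromBlocks_multiply,
    ← fromBlocks_one, fromBlocks_inj] at h
  simpa using And.intro h.1 h.2.2.2

/-- An equivalence between two block-triangular sets induces equivalences between
the diagonal blocks. -/
lemma RectEquiv.of_sumJoin {V : Set (Matrix m m K)} {W : Set (Matrix n n K)}
    {V' : Set (Matrix o o K)} {W' : Set (Matrix p p K)} [Nonempty m] [Nonempty o]
    (hV : Separating V) (hV0 : V.Nonempty) (hW0 : W.Nonempty) (hW : ∀ C ∈ W, IsUnit C)
    (hV' : Separating V') (hV0' : V'.Nonempty) (hW0' : W'.Nonempty) (hW' : ∀ C ∈ W', IsUnit C)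
    (h : RectEquiv (sumJoin V W) (sumJoin V' W')) :
    RectEquiv V V' ∧ RectEquiv W W' := by
  obtain ⟨R, R', S, S', h1, h2, h3, h4, hM⟩ := h
  have hM' : ∀ M ∈ sumJoin V' W', R' * M * S' ∈ sumJoin V W := fun M hMV => by
    rw [← hM]
    have : R * (R' * M * S') * S = (R * R') * M * (S' * S) := by simp only [Matrix.mul_assoc]
    rwa [this, h1, h4, Matrix.one_mul, Matrix.mul_one]
  have hR := toBlocks₂₁_eq_zero_of_sumJoin hV hV0 hW0 h4 fun M => (hM M).2
  have hR' := toBlocks₂₁_eq_zero_of_sumJoin hV' hV0' hW0' h3 hM'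
  obtain ⟨r1, r2⟩ := blocks_mul_eq_one hR hR' h1
  obtain ⟨r1', r2'⟩ := blocks_mul_eq_one hR' hR h2
  have hS := toBlocks₂₁_eq_zero_of_mul hV0 hW0 hW hR r2' fun M => (hM M).2
  have hS' := toBlocks₂₁_eq_zero_of_mul hV0' hW0' hW' hR' r2 hM'
  obtain ⟨s1, s2⟩ := blocks_mul_eq_one hS hS' h3
  obtain ⟨s1', s2'⟩ := blocks_mul_eq_one hS' hS h4
  have key : ∀ A C, (R.toBlocks₁₁ * A * S.toBlocks₁₁ ∈ V' ∧ R.toBlocks₂₂ * C * S.toBlocks₂₂ ∈ W')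
      ↔ (A ∈ V ∧ C ∈ W) := by
    intro A C
    have h0 := hM (fromBlocks A 0 0 C)
    rw [← fromBlocks_toBlocks R, ← fromBlocks_toBlocks S, hR, hS] at h0
    simpa [fromBlocks_multiply, sumJoin, fromBlocks_inj, and_assoc] using h0
  obtain ⟨A₀, hA₀⟩ := hV0
  obtain ⟨C₀, hC₀⟩ := hW0
  obtain ⟨hA₀', hC₀'⟩ := (key A₀ C₀).2 ⟨hA₀, hC₀⟩
  exact ⟨⟨_, _, _, _, r1, r1', s1, s1', fun A => by simpa [hC₀, hC₀'] using key A C₀⟩,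
    ⟨_, _, _, _, r2, r2', s2, s2', fun C => by simpa [hA₀, hA₀'] using key A₀ C⟩⟩

lemma exists_eq_smul_of_alternate_pairing_eq_zero {y w : m → K} (hw : w ≠ 0)
    (h : ∀ A : Matrix m m K, (∀ x : m → K, x ⬝ᵥ A *ᵥ x = 0) → y ⬝ᵥ A *ᵥ w = 0) :
    ∃ c : K, y = c • w := by
  obtain ⟨j, hj⟩ := Function.ne_iff.1 hw
  have hj' : w j ≠ 0 := hj
  refine ⟨y j * (w j)⁻¹, ?_⟩
  ext i
  have := h (Matrix.single i j 1 - Matrix.single j i 1) fun x => by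
    simp [sub_mulVec, Matrix.single_mulVec, dotProduct, Function.update_apply, mul_sub, mul_comm]
  simp [sub_mulVec, Matrix.single_mulVec, dotProduct, Function.update_apply, mul_sub] at this
  simp only [Pi.smul_apply, smul_eq_mul]
  field_simp
  linear_combination this

omit [DecidableEq m] in
lemma add_mem_quadClass {P A : Matrix m m K} (hA : ∀ x : m → K, x ⬝ᵥ A *ᵥ x = 0) :
    P + A ∈ quadClass P := fun x => by
  rw [add_mulVec, dotProduct_add, hA, add_zero]

lemma separating_quadClass {P : Matrix m m K} (hP : ∀ x : m → K, x ≠ 0 → x ⬝ᵥ P *ᵥ x ≠ 0) :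
    Separating (quadClass P) := by
  intro x hx y hy
  have h0 : y ⬝ᵥ P *ᵥ x = 0 := hy P fun _ => rfl
  obtain ⟨c, rfl⟩ := exists_eq_smul_of_alternate_pairing_eq_zero hx (y := y) fun A hA => by
    have := hy _ (add_mem_quadClass (P := P) hA)
    rwa [add_mulVec, dotProduct_add, h0, zero_add] at this
  rw [smul_dotProduct, smul_eq_mul, mul_eq_zero, or_iff_left (hP x hx)] at h0
  rw [h0, zero_smul]

lemma isUnit_of_mem_quadClass {P : Matrix m m K} (hP : ∀ x : m → K, x ≠ 0 → x ⬝ᵥ P *ᵥ x ≠ 0)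
    (M : Matrix m m K) (hM : M ∈ quadClass P) : IsUnit M := by
  rw [← mulVec_injective_iff_isUnit]
  refine (injective_iff_map_eq_zero (Matrix.mulVecLin M)).2 fun x hx => ?_
  by_contra hx0
  refine hP x hx0 ?_
  rw [← hM x, show M *ᵥ x = 0 from hx, dotProduct_zero]

omit [DecidableEq m] in
lemma dotProduct_transpose_mulVec_self (P : Matrix m m K) (x : m → K) :
    x ⬝ᵥ Pᵀ *ᵥ x = x ⬝ᵥ P *ᵥ x := by
  rw [mulVec_transpose, dotProduct_comm, ← dotProduct_mulVec]

end RectangularEquivalence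

section FinIndexed

variable {K : Type*} [Field K]

lemma rectEquiv_one_add_mul_altSet {n : ℕ} {P : Matrix (Fin n) (Fin n) K} (hP : IsUnit P) :
    RectEquiv ((fun A => 1 + P * A) '' altSet K n) (quadClass P) := by
  obtain ⟨N, h1, h2⟩ := isUnit_iff_exists.1 hP
  refine ⟨Pᵀ * N, P * Nᵀ, P, N, ?_, ?_, h1, h2, fun M => ?_⟩
  · rw [Matrix.mul_assoc, ← Matrix.mul_assoc N, h2, Matrix.one_mul, ← transpose_mul, h2,
      transpose_one]
  · rw [Matrix.mul_assoc, ← Matrix.mul_assoc Nᵀ, ← transpose_mul, h1, transpose_one,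
      Matrix.one_mul, h1]
  · obtain ⟨A, rfl⟩ : ∃ A, M = 1 + P * A :=
      ⟨N * (M - 1), by rw [← Matrix.mul_assoc, h1, Matrix.one_mul, add_sub_cancel]⟩
    have hinj : Function.Injective fun A => 1 + P * A := fun A B hAB => hP.mul_left_cancel <| by
      simpa using hAB
    rw [hinj.mem_set_image]
    have hform : Pᵀ * N * (1 + P * A) * P = Pᵀ + Pᵀ * A * P := by
      calc _ = Pᵀ * (N * P) + Pᵀ * (N * P) * A * P := by noncomm_ring
        _ = _ := by rw [h2, Matrix.mul_one]
    have hq : ∀ x, x ⬝ᵥ (Pᵀ * N * (1 + P * A) * P) *ᵥ x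
        = x ⬝ᵥ P *ᵥ x + (P *ᵥ x) ⬝ᵥ A *ᵥ (P *ᵥ x) := fun x => by
      rw [hform, add_mulVec, dotProduct_add, dotProduct_mulVec_sandwich, transpose_transpose,
        dotProduct_transpose_mulVec_self]
    constructor
    · intro h x
      have := h (N *ᵥ x)
      rwa [hq, add_eq_left, mulVec_mulVec, h1, one_mulVec] at this
    · intro h x
      rw [hq, h (P *ᵥ x), add_zero]

lemma exists_eq_smul_one_of_forall_mulVec {n : ℕ} (T : Matrix (Fin n) (Fin n) K)
    (h : ∀ x : Fin n → K, x ≠ 0 → ∃ c : K, T *ᵥ x = c • x) : ∃ c : K, T = c • 1 := by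
  obtain ⟨c, hc⟩ := (Matrix.toLin' T).exists_eq_smul_id_of_forall_notLinearIndependent fun x => by
    by_cases hx : x = 0
    · simp [hx, linearIndependent_fin2]
    · obtain ⟨c, hc⟩ := h x hx
      simpa [LinearIndependent.pair_iff' hx] using ⟨c, hc.symm⟩
  refine ⟨c, Matrix.toLin'.injective ?_⟩
  rw [hc, map_smul, Matrix.toLin'_one]
  rfl

lemma rectEquiv_quadClass_iff {n : ℕ} (hn : 0 < n) (P Q : Matrix (Fin n) (Fin n) K) :
    RectEquiv (quadClass P) (quadClass Q) ↔
      ∃ c : K, c ≠ 0 ∧ ∃ R : Matrix (Fin n) (Fin n) K, IsUnit R ∧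
        c • Q - R * P * Rᵀ ∈ altSet K n := by
  have : Nonempty (Fin n) := ⟨⟨0, hn⟩⟩
  constructor
  · rintro ⟨R, R', S, S', h1, h2, h3, h4, hM⟩
    have hP : ∀ x, x ⬝ᵥ (R * P * S) *ᵥ x = x ⬝ᵥ Q *ᵥ x := (hM P).2 fun _ => rfl
    have hA : ∀ A, (∀ x, x ⬝ᵥ A *ᵥ x = 0) → ∀ x, (Rᵀ *ᵥ x) ⬝ᵥ A *ᵥ (S *ᵥ x) = 0 := by
      intro A hA x
      have hPA := (hM (P + A)).2 (add_mem_quadClass hA) x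
      rwa [Matrix.mul_add, Matrix.add_mul, add_mulVec, dotProduct_add, hP, add_eq_left,
        dotProduct_mulVec_sandwich] at hPA
    obtain ⟨c, hc⟩ := exists_eq_smul_one_of_forall_mulVec (Rᵀ * S') fun x hx =>
      exists_eq_smul_of_alternate_pairing_eq_zero hx fun A hA' => by
        have := hA A hA' (S' *ᵥ x)
        rwa [mulVec_mulVec, mulVec_mulVec x S, h3, one_mulVec] at this
    have hRS : Rᵀ = c • S := by
      rw [← Matrix.mul_one Rᵀ, ← h4, ← Matrix.mul_assoc, hc, Matrix.smul_mul, Matrix.one_mul]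
    have hc0 : c ≠ 0 := by
      rintro rfl
      rw [zero_smul, transpose_eq_zero] at hRS
      rw [hRS, Matrix.zero_mul] at h1
      exact zero_ne_one h1
    refine ⟨c⁻¹, inv_ne_zero hc0, Sᵀ, (isUnit_transpose S).2 (IsUnit.of_mul_eq_one S' h3),
      fun x => ?_⟩
    have hR : R = c • Sᵀ := by rw [← transpose_transpose R, hRS, transpose_smul]
    rw [sub_mulVec, dotProduct_sub, smul_mulVec, dotProduct_smul, ← hP, hR]
    simp [smul_mulVec, dotProduct_smul, hc0]
  · rintro ⟨c, hc, R, hR, hA⟩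
    obtain ⟨N, h1, h2⟩ := isUnit_iff_exists.1 hR
    refine ⟨c⁻¹ • R, c • N, Rᵀ, Nᵀ, ?_, ?_, ?_, ?_, fun M => ?_⟩
    · simp [h1, hc]
    · simp [h2, hc]
    · rw [← transpose_mul, h2, transpose_one]
    · rw [← transpose_mul, h1, transpose_one]
    have hQ : ∀ x, c * (x ⬝ᵥ Q *ᵥ x) = (Rᵀ *ᵥ x) ⬝ᵥ P *ᵥ (Rᵀ *ᵥ x) := fun x => by
      have := hA x
      rwa [sub_mulVec, dotProduct_sub, smul_mulVec, dotProduct_smul, smul_eq_mul, sub_eq_zero,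
        dotProduct_mulVec_sandwich] at this
    have hq : ∀ x, x ⬝ᵥ (c⁻¹ • R * M * Rᵀ) *ᵥ x = x ⬝ᵥ Q *ᵥ x ↔
        (Rᵀ *ᵥ x) ⬝ᵥ M *ᵥ (Rᵀ *ᵥ x) = (Rᵀ *ᵥ x) ⬝ᵥ P *ᵥ (Rᵀ *ᵥ x) := fun x => by
      rw [← hQ, Matrix.smul_mul, Matrix.smul_mul, smul_mulVec, dotProduct_smul, smul_eq_mul,
        dotProduct_mulVec_sandwich, inv_mul_eq_iff_eq_mul₀ hc]
    constructor
    · intro h x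
      have := (hq (Nᵀ *ᵥ x)).1 (h _)
      rwa [mulVec_mulVec, ← transpose_mul, h2, transpose_one, one_mulVec] at this
    · exact fun h x => (hq x).2 (h _)

lemma rectEquiv_altSet_iff_qfSimilar {x y : Σ m : ℕ, Matrix (Fin m) (Fin m) K}
    (hx0 : 0 < x.1) (hx : IsUnit x.2) (hy : IsUnit y.2) :
    RectEquiv ((fun A => 1 + x.2 * A) '' altSet K x.1) ((fun A => 1 + y.2 * A) '' altSet K y.1) ↔
      qfSimilar x y := by
  obtain ⟨n, P⟩ := x
  obtain ⟨m, Q⟩ := y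
  have key : ∀ h : n = m, RectEquiv ((fun A => 1 + P * A) '' altSet K n)
      ((fun A => 1 + Q * A) '' altSet K m) ↔ qfSimilar ⟨n, P⟩ ⟨m, Q⟩ := by
    rintro rfl
    have h1 := rectEquiv_one_add_mul_altSet hx
    have h2 := rectEquiv_one_add_mul_altSet hy
    have h3 := rectEquiv_quadClass_iff hx0 P Q
    simp only [qfSimilar, exists_true_left, finCongr_refl, reindex_refl_refl]
    exact Iff.trans ⟨fun h => (h1.symm.trans h).trans h2, fun h => (h1.trans h).trans h2.symm⟩ h3
  constructor
  · intro h
    exact (key (by simpa using h.card_eq)).1 h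
  · intro h
    exact (key h.1).2 h

lemma rectEquiv_sumJoin_bdSetAff (x : Σ m : ℕ, Matrix (Fin m) (Fin m) K)
    (l : List (Σ m : ℕ, Matrix (Fin m) (Fin m) K)) :
    RectEquiv (sumJoin ((fun A => 1 + x.2 * A) '' altSet K x.1) (bdSetAff l))
      (bdSetAff (x :: l)) := by
  have h : bdSetAff (x :: l) = Matrix.reindex finSumFinEquiv finSumFinEquiv ''
      sumJoin ((fun A => 1 + x.2 * A) '' altSet K x.1) (bdSetAff l) := by
    ext M
    constructor
    · rintro ⟨A, hA, C, hC, B, rfl⟩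
      exact ⟨_, ⟨A, hA, C, hC, B, rfl⟩, rfl⟩
    · rintro ⟨_, ⟨A, hA, C, hC, B, rfl⟩, rfl⟩
      exact ⟨A, hA, C, hC, B, rfl⟩
  exact h ▸ RectEquiv.reindex_image finSumFinEquiv _

lemma altSet_nonempty (n : ℕ) : (altSet K n).Nonempty := ⟨0, fun x => by simp⟩

lemma isUnit_of_mem_one_add_mul_altSet {n : ℕ} {P : Matrix (Fin n) (Fin n) K} (hP : IsUnit P)
    (hP' : nonIsotropic P) : ∀ M ∈ (fun A => 1 + P * A) '' altSet K n, IsUnit M :=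
  (rectEquiv_one_add_mul_altSet hP).symm.isUnit (isUnit_of_mem_quadClass hP')

lemma separating_one_add_mul_altSet {n : ℕ} {P : Matrix (Fin n) (Fin n) K} (hP : IsUnit P)
    (hP' : nonIsotropic P) : Separating ((fun A => 1 + P * A) '' altSet K n) :=
  (rectEquiv_one_add_mul_altSet hP).symm.separating (separating_quadClass hP')

lemma bdSetAff_nonempty (l : List (Σ m : ℕ, Matrix (Fin m) (Fin m) K)) :
    (bdSetAff l).Nonempty := by
  induction l with
  | nil => exact ⟨0, trivial⟩
  | cons x l ih =>
    obtain ⟨C, hC⟩ := ih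
    obtain ⟨A, hA⟩ := (altSet_nonempty x.1).image fun A => (1 + x.2 * A : Matrix _ _ K)
    exact ⟨_, A, hA, C, hC, 0, rfl⟩

lemma isUnit_of_mem_bdSetAff (l : List (Σ m : ℕ, Matrix (Fin m) (Fin m) K))
    (hl : ∀ x ∈ l, IsUnit x.2 ∧ nonIsotropic x.2) : ∀ M ∈ bdSetAff l, IsUnit M := by
  induction l with
  | nil =>
    intro M _
    have : IsEmpty (Fin (sigSum ([] : List (Σ m : ℕ, Matrix (Fin m) (Fin m) K)))) :=
      Fin.isEmpty
    exact isUnit_of_subsingleton M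
  | cons x l ih =>
    rw [List.forall_mem_cons] at hl
    refine (rectEquiv_sumJoin_bdSetAff x l).isUnit ?_
    rintro _ ⟨A, hA, C, hC, B, rfl⟩
    exact isUnit_fromBlocks_zero₂₁.2
      ⟨isUnit_of_mem_one_add_mul_altSet hl.1.1 hl.1.2 A hA, ih hl.2 C hC⟩

lemma rectEquiv_bdSetAff_iff (l l' : List (Σ m : ℕ, Matrix (Fin m) (Fin m) K))
    (hl : ∀ x ∈ l, 0 < x.1 ∧ IsUnit x.2 ∧ nonIsotropic x.2)
    (hl' : ∀ x ∈ l', 0 < x.1 ∧ IsUnit x.2 ∧ nonIsotropic x.2) :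
    RectEquiv (bdSetAff l) (bdSetAff l') ↔ List.Forall₂ qfSimilar l l' := by
  induction l generalizing l' with
  | nil =>
    cases l' with
    | nil => exact iff_of_true ⟨1, 1, 1, 1, by simp, by simp, by simp, by simp,
        fun _ => Iff.rfl⟩ .nil
    | cons y l' =>
      refine iff_of_false (fun h => ?_) (fun h => nomatch h)
      have h0 := h.card_eq
      have := (hl' y (by simp)).1
      rw [Fintype.card_fin, Fintype.card_fin] at h0
      simp only [sigSum] at h0
      omega
  | cons x l ih =>
    cases l' with
    | nil =>
      refine iff_of_false (fun h => ?_) (fun h => nomatch h)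
      have h0 := h.card_eq
      have := (hl x (by simp)).1
      rw [Fintype.card_fin, Fintype.card_fin] at h0
      simp only [sigSum] at h0
      omega
    | cons y l' =>
      rw [List.forall_mem_cons] at hl hl'
      obtain ⟨⟨hx0, hx, hxn⟩, hl⟩ := hl
      obtain ⟨⟨hy0, hy, hyn⟩, hl'⟩ := hl'
      rw [List.forall₂_cons, ← ih l' hl hl', ← rectEquiv_altSet_iff_qfSimilar hx0 hx hy]
      have : Nonempty (Fin x.1) := ⟨⟨0, hx0⟩⟩
      have : Nonempty (Fin y.1) := ⟨⟨0, hy0⟩⟩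
      have e := rectEquiv_sumJoin_bdSetAff x l
      have e' := rectEquiv_sumJoin_bdSetAff y l'
      constructor
      · intro h
        exact RectEquiv.of_sumJoin (separating_one_add_mul_altSet hx hxn)
          ((altSet_nonempty _).image _) (bdSetAff_nonempty l)
          (isUnit_of_mem_bdSetAff l fun z hz => (hl z hz).2)
          (separating_one_add_mul_altSet hy hyn)
          ((altSet_nonempty _).image _) (bdSetAff_nonempty l')
          (isUnit_of_mem_bdSetAff l' fun z hz => (hl' z hz).2) ((e.trans h).trans e'.symm)
      · rintro ⟨h1, h2⟩
        exact (e.symm.trans (h1.sumJoin_congr h2)).trans e'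

lemma equivSets_iff_rectEquiv {n : ℕ} (V W : Set (Matrix (Fin n) (Fin n) K)) :
    EquivSets V W ↔ RectEquiv V W := by
  constructor
  · rintro ⟨R, S, hR, hS, rfl⟩
    obtain ⟨R', h1, h2⟩ := isUnit_iff_exists.1 hR
    obtain ⟨S', h3, h4⟩ := isUnit_iff_exists.1 hS
    refine ⟨R, R', S, S', h1, h2, h3, h4, fun M => ?_⟩
    have hinj : Function.Injective fun M => R * M * S := fun A B hAB =>
      hR.mul_left_cancel (hS.mul_right_cancel hAB)
    exact hinj.mem_set_image
  · rintro ⟨R, R', S, S', h1, h2, h3, h4, hM⟩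
    refine ⟨R, S, IsUnit.of_mul_eq_one R' h1, IsUnit.of_mul_eq_one S' h3, ?_⟩
    ext M
    have hMM : R * (R' * M * S') * S = M := by
      calc _ = (R * R') * M * (S' * S) := by simp only [Matrix.mul_assoc]
        _ = M := by rw [h1, h4, Matrix.one_mul, Matrix.mul_one]
    constructor
    · exact fun h => ⟨R' * M * S', (hM _).1 (by rwa [hMM]), hMM⟩
    · rintro ⟨N, hN, rfl⟩
      exact (hM N).2 hN

end FinIndexed

/-- `(I_{n_1} + P_1·Alt_{n_1}(K)) ∨ ⋯ ∨ (I_{n_p} + P_p·Alt_{n_p}(K))` is equivalent to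
`(I_{m_1} + Q_1·Alt_{m_1}(K)) ∨ ⋯ ∨ (I_{m_q} + Q_q·Alt_{m_q}(K))` if and only if `p = q`,
`n_k = m_k` for all `k`, and the quadratic forms `X ↦ Xᵀ P_k X` and `X ↦ Xᵀ Q_k X` are
similar for each `k`. -/
theorem affine_pAlt_blocks_equiv_iff (K : Type*) [Field K] (n : ℕ)
    (l l' : List (Σ m : ℕ, Matrix (Fin m) (Fin m) K))
    (hl : ∀ x ∈ l, 0 < x.1 ∧ IsUnit x.2 ∧ nonIsotropic x.2)
    (hl' : ∀ x ∈ l', 0 < x.1 ∧ IsUnit x.2 ∧ nonIsotropic x.2)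
    (h : sigSum l = n) (h' : sigSum l' = n) :
    EquivSets ((Matrix.reindex (finCongr h) (finCongr h)) '' bdSetAff l)
        ((Matrix.reindex (finCongr h') (finCongr h')) '' bdSetAff l') ↔
      List.Forall₂ qfSimilar l l' := by
  rw [equivSets_iff_rectEquiv, ← rectEquiv_bdSetAff_iff l l' hl hl']
  have e := RectEquiv.reindex_image (finCongr h) (bdSetAff l)
  have e' := RectEquiv.reindex_image (finCongr h') (bdSetAff l')
  exact ⟨fun k => (e.trans k).trans e'.symm, fun k => (e.symm.trans k).trans e'⟩
end

section
/- Let K be a field and W a linear subspace of M_p(K) with a trivial spectrum. Then there exists an index i ∈ {1,…,p} such that the only matrix M ∈ W whose image (column space) is contained in the span of the i-th canonical basis vector e_i of K^p is the zero matrix; in particular there exists a non-zero vector X ∈ K^p such that W contains no matrix with span{X} as its column space. -/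
open Matrix

/-- A linear subspace of matrices has a trivial spectrum if no matrix of it
possesses a non-zero invariant vector. -/
def TrivialSpectrum {K : Type*} [Field K] {p : ℕ} (W : Set (Matrix (Fin p) (Fin p) K)) : Prop :=
  ∀ M ∈ W, ∀ X : Fin p → K, M.mulVec X = X → X = 0

/-- In a finite directed graph in which every vertex has an out-neighbour, some nonempty set of
vertices induces a subgraph in which every vertex has exactly one out-neighbour. -/
theorem exists_finset_existsUnique_rel {ι : Type*} [Fintype ι] [Nonempty ι]
    (r : ι → ι → Prop) (h : ∀ i, ∃ j, r i j) :
    ∃ S : Finset ι, S.Nonempty ∧ ∀ i ∈ S, ∃! j, j ∈ S ∧ r i j := by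
  classical
  obtain ⟨S, ⟨hne, hS⟩, hmin⟩ := exists_minimal_of_wellFoundedLT
    (fun S : Finset ι => S.Nonempty ∧ ∀ i ∈ S, ∃ j ∈ S, r i j)
    ⟨Finset.univ, Finset.univ_nonempty, by simpa using h⟩
  -- By minimality, every choice of out-neighbours within `S` permutes `S`.
  have image_eq (f : ι → ι) (hf : ∀ i ∈ S, f i ∈ S ∧ r i (f i)) : S.image f = S := by
    have hsub : S.image f ⊆ S := Finset.image_subset_iff.2 fun i hi => (hf i hi).1
    refine hsub.antisymm (hmin ⟨hne.image f, fun i hi => ?_⟩ hsub)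
    exact ⟨f i, Finset.mem_image_of_mem f (hsub hi), (hf i (hsub hi)).2⟩
  choose! f hf using hS
  refine ⟨S, hne, fun i hi => ⟨f i, hf i hi, fun k ⟨hk, hik⟩ => ?_⟩⟩
  let g := Function.update f i k
  have hg : S.image g = S := image_eq g fun m hm => by
    by_cases hmi : m = i
    · subst hmi
      simpa [g] using And.intro hk hik
    · simpa [g, hmi] using hf m hm
  have hinj : Set.InjOn g S := Finset.card_image_iff.1 (congrArg Finset.card hg)
  obtain ⟨m, hm, hmk⟩ := Finset.mem_image.1 ((image_eq f hf).symm ▸ hk)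
  by_cases hmi : m = i
  · rw [← hmk, hmi]
  · exact absurd (hinj hm hi (by simp [g, hmi, hmk])) hmi

/-- If every row of a square matrix is nonzero, then there is a nonzero vector `x` such that
`A *ᵥ x` does not vanish on the support of `x`. -/
theorem exists_ne_zero_mulVec_ne_zero_on_support {K ι : Type*} [Field K] [Fintype ι] [Nonempty ι]
    (A : Matrix ι ι K) (hA : ∀ i, A i ≠ 0) :
    ∃ x : ι → K, x ≠ 0 ∧ ∀ i, x i ≠ 0 → (A *ᵥ x) i ≠ 0 := by
  classical
  obtain ⟨S, ⟨s, hs⟩, hS⟩ := exists_finset_existsUnique_rel (fun i j => A i j ≠ 0)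
    fun i => Function.ne_iff.1 (hA i)
  refine ⟨fun i => if i ∈ S then 1 else 0, fun h => by simpa [hs] using congrFun h s,
    fun i hi => ?_⟩
  have hiS : i ∈ S := by
    by_contra hiS
    simp [hiS] at hi
  obtain ⟨j, ⟨hj, hij⟩, huniq⟩ := hS i hiS
  have hsum : ∑ k ∈ S, A i k = A i j := by
    refine Finset.sum_eq_single_of_mem j hj fun k hk hkj => ?_
    by_contra hik
    exact hkj (huniq k ⟨hk, hik⟩)
  simpa [mulVec, dotProduct, hsum] using hij

/-- A space of matrices with a trivial spectrum contains no nonzero matrix with column space in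
`span {e_i}`, for some index `i`. -/
theorem TrivialSpectrum.exists_index {K : Type*} [Field K] {p : ℕ} (hp : 0 < p)
    {W : Submodule K (Matrix (Fin p) (Fin p) K)}
    (htriv : TrivialSpectrum (W : Set (Matrix (Fin p) (Fin p) K))) :
    ∃ i : Fin p, ∀ M ∈ W,
      (∀ X : Fin p → K, M.mulVec X ∈ Submodule.span K {Pi.single i (1 : K)}) → M = 0 := by
  by_contra! hcon
  have : Nonempty (Fin p) := ⟨⟨0, hp⟩⟩
  choose M hMW hspan hM using hcon
  have hrow (i k : Fin p) (hki : k ≠ i) (X : Fin p → K) : (M i *ᵥ X) k = 0 := by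
    obtain ⟨c, hc⟩ := Submodule.mem_span_singleton.1 (hspan i X)
    simp [← hc, hki]
  have hne (i : Fin p) : M i i ≠ 0 := fun h0 => hM i <| by
    ext k l
    by_cases hki : k = i
    · rw [hki, h0]
      rfl
    · simpa using hrow i k hki (Pi.single l 1)
  obtain ⟨x, hx0, hx⟩ := exists_ne_zero_mulVec_ne_zero_on_support (Matrix.of fun i => M i i) hne
  refine hx0 (htriv (∑ i, (x i / (M i *ᵥ x) i) • M i)
    (W.sum_mem fun i _ => W.smul_mem _ (hMW i)) x ?_)
  ext k
  rw [Matrix.sum_mulVec, Finset.sum_apply, Finset.sum_eq_single k]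
  · rw [Matrix.smul_mulVec, Pi.smul_apply, smul_eq_mul]
    exact div_mul_cancel_of_imp fun h => by_contra fun hk => hx k hk h
  · intro i _ hik
    rw [Matrix.smul_mulVec, Pi.smul_apply, hrow i k hik.symm, smul_zero]
  · simp

/-- Let `W` be a linear subspace of `M_p(K)` with a trivial spectrum.  Then there is an
index `i` such that the only matrix of `W` whose column space is contained in the line
spanned by `e_i` is zero; in particular there is a non-zero vector `X` such that no
matrix of `W` has `span {X}` as its column space. -/
theorem exists_vector_not_column_space (K : Type*) [Field K] (p : ℕ) (hp : 0 < p)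
    (W : Submodule K (Matrix (Fin p) (Fin p) K))
    (htriv : TrivialSpectrum (W : Set (Matrix (Fin p) (Fin p) K))) :
    (∃ i : Fin p, ∀ M ∈ W,
      (∀ X : Fin p → K, M.mulVec X ∈ Submodule.span K {Pi.single i (1 : K)}) → M = 0) ∧
    (∃ X : Fin p → K, X ≠ 0 ∧ ∀ M ∈ W,
      LinearMap.range (Matrix.mulVecLin M) ≠ Submodule.span K {X}) := by
  obtain ⟨i, hi⟩ := htriv.exists_index hp
  refine ⟨⟨i, hi⟩, Pi.single i 1, by simp, fun M hM hrange => ?_⟩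
  have hM0 : M = 0 := hi M hM fun X => hrange ▸ LinearMap.mem_range_self M.mulVecLin X
  have hspan := hrange.symm
  rw [hM0, mulVecLin_zero, LinearMap.range_zero, Submodule.span_singleton_eq_bot] at hspan
  simp at hspan
end
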